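/- Let p, q : [0,1) → ℝ be integrable, ξ ∈ [0,1), η ∈ ℝ, n ∈ ℕ, n ≥ 1, and let k* ∈ {1,…,2^n} be the index with ξ ∈ I_n(k*). Write p̃_n = S_{2^n}p and q̃_n = S_{2^n}q. If ȳ_n is a Walsh polynomial of degree < 2^n satisfying ȳ_n(x) = η + S_{2^n}( ∫_ξ^{·} (q̃_n(t) − p̃_n(t) ȳ_n(t)) dt )(x) for all x ∈ [0,1), then for every i ∈ {1,…,2^n} with i > k*: ȳ_n((i−1)/2^n) · (1 + p̃_n((i−1)/2^n)/2^{n+1}) = η + (q̃_n((k*−1)/2^n) − p̃_n((k*−1)/2^n) ȳ_n((k*−1)/2^n))·(k*/2^n − ξ) + Σ_{k=k*+1}^{i−1} (q̃_n((k−1)/2^n) − p̃_n((k−1)/2^n) ȳ_n((k−1)/2^n))/2^n + q̃_n((i−1)/2^n)/2^{n+1}. -/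

import Mathlib

open MeasureTheory Matrix

/-- The `k`-th binary digit of `x ∈ [0,1)`, using the expansion terminating in zeros
for dyadic rationals. -/
noncomputable def binDigit (k : ℕ) (x : ℝ) : ℕ := ⌊x * 2 ^ (k + 1)⌋.toNat % 2

/-- Rademacher functions `r_k(x) = (-1)^{x_k}`. -/
noncomputable def rademacher (k : ℕ) (x : ℝ) : ℝ := (-1 : ℝ) ^ binDigit k x

/-- Walsh–Paley functions `ω_n(x) = ∏_k r_k(x)^{n_k}`. -/
noncomputable def walsh (n : ℕ) (x : ℝ) : ℝ :=
  ∏ k ∈ Finset.range n, if n.testBit k then rademacher k x else 1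

/-- Walsh–Fourier coefficient `f̂_k = ∫₀¹ f ω_k`. -/
noncomputable def fcoef (f : ℝ → ℝ) (k : ℕ) : ℝ := ∫ x in (0:ℝ)..1, f x * walsh k x

/-- The `2^n`-th partial sum of the Walsh–Fourier series:
`S_{2^n} f (x) = ∑_{k<2^n} f̂_k ω_k(x)`. -/
noncomputable def S2 (n : ℕ) (f : ℝ → ℝ) (x : ℝ) : ℝ :=
  ∑ k ∈ Finset.range (2 ^ n), fcoef f k * walsh k x

/-- Halving the index of the dyadic interval of order `n + 1` gives the index of order `n`. -/
theorem floor_mul_two_pow_div (x : ℝ) (j m : ℕ) :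
    ⌊x * 2 ^ (j + m)⌋₊ / 2 ^ m = ⌊x * 2 ^ j⌋₊ := by
  have h := Nat.floor_div_natCast (x * 2 ^ (j + m)) (2 ^ m)
  rw [← h]
  congr 1
  push_cast
  rw [pow_add]
  field_simp

theorem binDigit_eq (k : ℕ) (x : ℝ) : binDigit k x = ⌊x * 2 ^ (k + 1)⌋₊ % 2 := by
  rw [binDigit, Int.floor_toNat]

theorem rademacher_congr {n k : ℕ} (hk : k < n) {x y : ℝ}
    (h : ⌊x * 2 ^ n⌋₊ = ⌊y * 2 ^ n⌋₊) : rademacher k x = rademacher k y := by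
  obtain ⟨m, rfl⟩ := Nat.exists_eq_add_of_le (Nat.succ_le_of_lt hk)
  rw [rademacher, rademacher, binDigit_eq, binDigit_eq, ← floor_mul_two_pow_div x (k + 1) m,
    ← floor_mul_two_pow_div y (k + 1) m]
  simp only [Nat.succ_eq_add_one] at h
  rw [h]

theorem rademacher_mul_rademacher (k : ℕ) (x y : ℝ) :
    rademacher k x * rademacher k y = if binDigit k x = binDigit k y then 1 else -1 := by
  unfold rademacher
  have hx : binDigit k x < 2 := Nat.mod_lt _ two_pos
  have hy : binDigit k y < 2 := Nat.mod_lt _ two_pos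
  generalize binDigit k x = a at *
  generalize binDigit k y = b at *
  interval_cases a <;> interval_cases b <;> norm_num

theorem abs_rademacher (k : ℕ) (x : ℝ) : |rademacher k x| = 1 := by
  simp [rademacher]

theorem measurable_rademacher (k : ℕ) : Measurable (rademacher k) := by
  have h : rademacher k = fun x => (-1 : ℝ) ^ (⌊x * 2 ^ (k + 1)⌋₊ % 2) := by
    funext x
    rw [rademacher, binDigit_eq]
  rw [h]
  exact (measurable_from_nat (f := fun m : ℕ => (-1 : ℝ) ^ (m % 2))).comp
    (Nat.measurable_floor.comp (measurable_id.mul_const _))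

/-- The product defining a Walsh function may be taken over any sufficiently long range. -/
theorem walsh_eq_prod {n k : ℕ} (hk : k < 2 ^ n) (x : ℝ) :
    walsh k x = ∏ j ∈ Finset.range n, if k.testBit j then rademacher j x else 1 := by
  have key : ∀ a b : ℕ, a ≤ b → k < 2 ^ a →
      (∏ j ∈ Finset.range b, if k.testBit j then rademacher j x else 1) =
        ∏ j ∈ Finset.range a, if k.testBit j then rademacher j x else 1 := by
    intro a b hab hka
    symm
    refine Finset.prod_subset (Finset.range_mono hab) fun j _ hj => ?_
    have hj' : a ≤ j := by simpa using hj
    rw [Nat.testBit_lt_two_pow (hka.trans_le (Nat.pow_le_pow_right two_pos hj'))]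
    simp
  rw [walsh]
  rcases le_total k n with h | h
  · exact (key k n h Nat.lt_two_pow_self).symm
  · exact key n k h hk

theorem walsh_congr {n k : ℕ} (hk : k < 2 ^ n) {x y : ℝ}
    (h : ⌊x * 2 ^ n⌋₊ = ⌊y * 2 ^ n⌋₊) : walsh k x = walsh k y := by
  rw [walsh_eq_prod hk, walsh_eq_prod hk]
  refine Finset.prod_congr rfl fun j hj => ?_
  rw [rademacher_congr (Finset.mem_range.1 hj) h]

theorem walsh_two_pow_add {n k : ℕ} (hk : k < 2 ^ n) (x : ℝ) :
    walsh (2 ^ n + k) x = walsh k x * rademacher n x := by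
  have h : 2 ^ n + k < 2 ^ (n + 1) := by rw [pow_succ]; omega
  rw [walsh_eq_prod h, walsh_eq_prod hk, Finset.prod_range_succ, Nat.testBit_two_pow_add_eq,
    Nat.testBit_lt_two_pow hk]
  congr 1
  refine Finset.prod_congr rfl fun j hj => ?_
  rw [Nat.testBit_two_pow_add_gt (Finset.mem_range.1 hj)]

theorem abs_walsh (k : ℕ) (x : ℝ) : |walsh k x| = 1 := by
  rw [walsh, Finset.abs_prod]
  refine Finset.prod_eq_one fun j _ => ?_
  split_ifs
  · exact abs_rademacher j x
  · simp

theorem measurable_walsh (k : ℕ) : Measurable (walsh k) := by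
  unfold walsh
  refine Finset.measurable_fun_prod _ fun j _ => ?_
  split_ifs
  · exact measurable_rademacher j
  · exact measurable_const

/-- The Walsh–Dirichlet kernel of order `2 ^ n` is supported on the dyadic squares of order
`n` along the diagonal. -/
theorem sum_walsh_mul_walsh (n : ℕ) {x y : ℝ} (hx : x ∈ Set.Ico (0 : ℝ) 1)
    (hy : y ∈ Set.Ico (0 : ℝ) 1) :
    ∑ k ∈ Finset.range (2 ^ n), walsh k x * walsh k y =
      if ⌊x * 2 ^ n⌋₊ = ⌊y * 2 ^ n⌋₊ then 2 ^ n else 0 := by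
  induction n with
  | zero => simp [walsh, Nat.floor_eq_zero.2 hx.2, Nat.floor_eq_zero.2 hy.2]
  | succ n ih =>
    have h : ∑ k ∈ Finset.range (2 ^ (n + 1)), walsh k x * walsh k y =
        (∑ k ∈ Finset.range (2 ^ n), walsh k x * walsh k y) *
          (1 + rademacher n x * rademacher n y) := by
      rw [pow_succ, mul_two, Finset.sum_range_add, mul_add, mul_one, Finset.sum_mul]
      congr 1
      refine Finset.sum_congr rfl fun k hk => ?_
      rw [walsh_two_pow_add (Finset.mem_range.1 hk), walsh_two_pow_add (Finset.mem_range.1 hk)]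
      ring
    rw [h, ih, rademacher_mul_rademacher, binDigit_eq, binDigit_eq]
    have hx' := floor_mul_two_pow_div x n 1
    have hy' := floor_mul_two_pow_div y n 1
    rw [← hx', ← hy', pow_one]
    by_cases h1 : ⌊x * 2 ^ (n + 1)⌋₊ = ⌊y * 2 ^ (n + 1)⌋₊
    · simp [h1]
      ring
    · by_cases h2 : ⌊x * 2 ^ (n + 1)⌋₊ / 2 = ⌊y * 2 ^ (n + 1)⌋₊ / 2
      · have h3 : ¬ ⌊x * 2 ^ (n + 1)⌋₊ % 2 = ⌊y * 2 ^ (n + 1)⌋₊ % 2 := by omega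
        simp [h1, h3]
      · simp [h1, h2]

theorem floor_mul_two_pow_eq_iff {n i : ℕ} {t : ℝ} (ht : 0 ≤ t) :
    ⌊t * 2 ^ n⌋₊ = i ↔ t ∈ Set.Ico ((i : ℝ) / 2 ^ n) (((i : ℝ) + 1) / 2 ^ n) := by
  rw [Nat.floor_eq_iff (by positivity), Set.mem_Ico, div_le_iff₀ (by positivity),
    lt_div_iff₀ (by positivity)]

/-- The partial sum `S_{2^n} f` averages `f` over the dyadic intervals of order `n`. -/
theorem S2_eq_integral {n i : ℕ} (hi : i < 2 ^ n) {f : ℝ → ℝ}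
    (hf : IntervalIntegrable f volume 0 1) :
    S2 n f ((i : ℝ) / 2 ^ n) =
      2 ^ n * ∫ t in ((i : ℝ) / 2 ^ n)..(((i : ℝ) + 1) / 2 ^ n), f t := by
  have hpos : (0 : ℝ) < 2 ^ n := by positivity
  have hi' : (i : ℝ) + 1 ≤ 2 ^ n := by exact_mod_cast hi
  have h0 : (0 : ℝ) ≤ (i : ℝ) / 2 ^ n := by positivity
  have h01 : (i : ℝ) / 2 ^ n ≤ ((i : ℝ) + 1) / 2 ^ n := by gcongr; linarith
  have h1 : ((i : ℝ) + 1) / 2 ^ n ≤ 1 := by rw [div_le_one hpos]; exact hi'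
  have hx : (i : ℝ) / 2 ^ n ∈ Set.Ico (0 : ℝ) 1 :=
    ⟨h0, by rw [div_lt_one hpos]; linarith⟩
  have hfl : ⌊(i : ℝ) / 2 ^ n * 2 ^ n⌋₊ = i := by
    rw [div_mul_cancel₀ _ hpos.ne', Nat.floor_natCast]
  have hint : ∀ k, IntervalIntegrable (fun t => f t * walsh k t) volume 0 1 := fun k => by
    rw [intervalIntegrable_iff] at hf ⊢
    exact hf.mul_bdd (c := 1) (measurable_walsh k).aestronglyMeasurable
      (Filter.Eventually.of_forall fun t => (abs_walsh k t).le)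
  unfold S2 fcoef
  simp_rw [← intervalIntegral.integral_mul_const]
  rw [← intervalIntegral.integral_finsetSum fun k _ => (hint k).mul_const _,
    ← intervalIntegral.integral_const_mul, intervalIntegral.integral_of_le zero_le_one,
    intervalIntegral.integral_of_le h01, ← integral_Ico_eq_integral_Ioc,
    ← integral_Ico_eq_integral_Ioc]
  have hsub : Set.Ico ((i : ℝ) / 2 ^ n) (((i : ℝ) + 1) / 2 ^ n) ⊆ Set.Ico (0 : ℝ) 1 :=
    Set.Ico_subset_Ico h0 h1
  have hker : ∀ t ∈ Set.Ico (0 : ℝ) 1,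
      ∑ k ∈ Finset.range (2 ^ n), f t * walsh k t * walsh k ((i : ℝ) / 2 ^ n) =
        (Set.Ico ((i : ℝ) / 2 ^ n) (((i : ℝ) + 1) / 2 ^ n)).indicator
          (fun t => 2 ^ n * f t) t := by
    intro t ht
    simp_rw [mul_assoc]
    rw [← Finset.mul_sum, sum_walsh_mul_walsh n ht hx, hfl]
    simp_rw [floor_mul_two_pow_eq_iff ht.1, Set.indicator_apply]
    split_ifs <;> ring
  rw [setIntegral_congr_fun measurableSet_Ico hker, setIntegral_indicator measurableSet_Ico,
    Set.inter_eq_right.2 hsub]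

/-- A function which is constant on `[a, b)` has an affine primitive there. -/
theorem integral_of_const_on_Ico {g : ℝ → ℝ} {a b c s t : ℝ}
    (hg : ∀ u ∈ Set.Ico a b, g u = c) (has : a ≤ s) (hst : s ≤ t) (htb : t ≤ b) :
    ∫ u in s..t, g u = c * (t - s) := by
  rw [intervalIntegral.integral_of_le hst, ← integral_Ico_eq_integral_Ioc,
    setIntegral_congr_fun measurableSet_Ico fun u hu => hg u ⟨has.trans hu.1, hu.2.trans_le htb⟩,
    integral_Ico_eq_integral_Ioc, ← intervalIntegral.integral_of_le hst]
  simp [mul_comm]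

theorem measurable_sum_mul_walsh {ι : Type*} (s : Finset ι) (c : ι → ℝ) (m : ι → ℕ) :
    Measurable fun x => ∑ k ∈ s, c k * walsh (m k) x :=
  Finset.measurable_fun_sum _ fun k _ => (measurable_walsh (m k)).const_mul (c k)

theorem abs_sum_mul_walsh_le {ι : Type*} (s : Finset ι) (c : ι → ℝ) (m : ι → ℕ) (x : ℝ) :
    |∑ k ∈ s, c k * walsh (m k) x| ≤ ∑ k ∈ s, |c k| := by
  refine (Finset.abs_sum_le_sum_abs _ _).trans_eq (Finset.sum_congr rfl fun k _ => ?_)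
  rw [abs_mul, abs_walsh, mul_one]

theorem intervalIntegrable_of_measurable_of_bounded {g : ℝ → ℝ} (hg : Measurable g) {C : ℝ}
    (hC : ∀ x, |g x| ≤ C) (a b : ℝ) : IntervalIntegrable g volume a b :=
  (intervalIntegrable_const (c := C)).mono_fun hg.aestronglyMeasurable
    (Filter.Eventually.of_forall fun x => (hC x).trans (le_abs_self C))

theorem integral_affine (a b A B : ℝ) :
    ∫ s in a..b, (A + B * (s - a)) = A * (b - a) + B * (b - a) ^ 2 / 2 := by
  rw [intervalIntegral.integral_add (by simp) (Continuous.intervalIntegrable (by fun_prop) _ _),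
    intervalIntegral.integral_const_mul, intervalIntegral.integral_sub (by simp) (by simp),
    integral_id, intervalIntegral.integral_const, intervalIntegral.integral_const]
  simp only [smul_eq_mul]
  ring

/-- The integral of a dyadic step function of order `n` from `ξ` to a dyadic point. -/
theorem integral_dyadic_step {g : ℝ → ℝ} (hg : ∀ a b, IntervalIntegrable g volume a b) {n : ℕ}
    (hc : ∀ j : ℕ, ∀ t ∈ Set.Ico ((j : ℝ) / 2 ^ n) (((j : ℝ) + 1) / 2 ^ n),
      g t = g ((j : ℝ) / 2 ^ n))
    {ξ : ℝ} {k : ℕ} (h1 : (k : ℝ) / 2 ^ n ≤ ξ) (h2 : ξ < ((k : ℝ) + 1) / 2 ^ n)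
    {i : ℕ} (hi : k + 1 ≤ i) :
    ∫ t in ξ..((i : ℝ) / 2 ^ n), g t =
      g ((k : ℝ) / 2 ^ n) * (((k : ℝ) + 1) / 2 ^ n - ξ) +
        ∑ j ∈ Finset.Ico (k + 1) i, g ((j : ℝ) / 2 ^ n) / 2 ^ n := by
  induction i, hi using Nat.le_induction with
  | base =>
    push_cast
    simpa using integral_of_const_on_Ico (hc k) h1 h2.le le_rfl
  | succ i hi ih =>
    have hle : (i : ℝ) / 2 ^ n ≤ ((i : ℝ) + 1) / 2 ^ n := by gcongr; linarith
    rw [← intervalIntegral.integral_add_adjacent_intervals (hg ξ ((i : ℝ) / 2 ^ n)) (hg _ _), ih,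
      Finset.sum_Ico_succ_top hi]
    push_cast
    rw [integral_of_const_on_Ico (hc i) le_rfl hle le_rfl]
    ring

/-- Case `k* < i` of the multistep algorithm: the recursion for the discretized
solution on dyadic intervals to the right of the one containing `ξ`. -/
theorem multistep_case_greater (p q : ℝ → ℝ)
    (hpi : IntegrableOn p (Set.Ico (0:ℝ) 1)) (hqi : IntegrableOn q (Set.Ico (0:ℝ) 1))
    (ξ : ℝ) (hξ : ξ ∈ Set.Ico (0:ℝ) 1) (η : ℝ) (n : ℕ) (hn : 1 ≤ n)
    (kstar : ℕ) (hk1 : 1 ≤ kstar) (hk2 : kstar ≤ 2 ^ n)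
    (hξ1 : ((kstar : ℝ) - 1) / 2 ^ n ≤ ξ) (hξ2 : ξ < (kstar : ℝ) / 2 ^ n)
    (ybar : ℝ → ℝ)
    (hpoly : ∃ c : Fin (2 ^ n) → ℝ, ∀ x : ℝ, ybar x = ∑ k : Fin (2 ^ n), c k * walsh k.1 x)
    (heq : ∀ x ∈ Set.Ico (0:ℝ) 1,
      ybar x = η + S2 n (fun s => ∫ t in ξ..s, (S2 n q t - S2 n p t * ybar t)) x) :
    ∀ i : ℕ, kstar < i → i ≤ 2 ^ n →
      ybar (((i : ℝ) - 1) / 2 ^ n) *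
          (1 + S2 n p (((i : ℝ) - 1) / 2 ^ n) / 2 ^ (n + 1)) =
        η + (S2 n q (((kstar : ℝ) - 1) / 2 ^ n) -
              S2 n p (((kstar : ℝ) - 1) / 2 ^ n) * ybar (((kstar : ℝ) - 1) / 2 ^ n)) *
            ((kstar : ℝ) / 2 ^ n - ξ) +
          (∑ k ∈ Finset.Ioo kstar i,
            (S2 n q (((k : ℝ) - 1) / 2 ^ n) -
              S2 n p (((k : ℝ) - 1) / 2 ^ n) * ybar (((k : ℝ) - 1) / 2 ^ n)) / 2 ^ n) +
          S2 n q (((i : ℝ) - 1) / 2 ^ n) / 2 ^ (n + 1) := by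
  intro i hki hi
  obtain ⟨c, hc⟩ := hpoly
  obtain ⟨k, rfl⟩ := Nat.exists_eq_add_of_le' hk1
  obtain ⟨l, rfl⟩ := Nat.exists_eq_add_of_le' (hk1.trans hki.le)
  have hcast : ∀ m : ℕ, (((m + 1 : ℕ) : ℝ) - 1) = m := fun m => by push_cast; ring
  set g : ℝ → ℝ := fun t => S2 n q t - S2 n p t * ybar t with hg
  have hmS : ∀ f, Measurable (S2 n f) := fun f => measurable_sum_mul_walsh _ _ id
  have hyeq : ybar = fun x => ∑ k : Fin (2 ^ n), c k * walsh k.1 x := funext hc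
  have hmy : Measurable ybar := by
    rw [hyeq]
    exact measurable_sum_mul_walsh _ c Fin.val
  have hby : ∀ x, |ybar x| ≤ ∑ k, |c k| := fun x => by
    rw [hc]
    exact abs_sum_mul_walsh_le _ c Fin.val x
  have hbS : ∀ f x, |S2 n f x| ≤ ∑ k ∈ Finset.range (2 ^ n), |fcoef f k| :=
    fun f x => abs_sum_mul_walsh_le _ (fcoef f) id x
  have hgint : ∀ a b, IntervalIntegrable g volume a b := by
    refine intervalIntegrable_of_measurable_of_bounded ((hmS q).sub ((hmS p).mul hmy))
      (C := (∑ k ∈ Finset.range (2 ^ n), |fcoef q k|) +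
        (∑ k ∈ Finset.range (2 ^ n), |fcoef p k|) * ∑ k, |c k|) fun x => ?_
    refine (abs_sub _ _).trans (add_le_add (hbS q x) ?_)
    rw [abs_mul]
    exact mul_le_mul (hbS p x) (hby x) (abs_nonneg _) (Finset.sum_nonneg fun _ _ => abs_nonneg _)
  have hgc : ∀ j : ℕ, ∀ t ∈ Set.Ico ((j : ℝ) / 2 ^ n) (((j : ℝ) + 1) / 2 ^ n),
      g t = g ((j : ℝ) / 2 ^ n) := by
    intro j t ht
    have h0 : (0 : ℝ) ≤ (j : ℝ) / 2 ^ n := by positivity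
    have hfl : ⌊t * 2 ^ n⌋₊ = ⌊(j : ℝ) / 2 ^ n * 2 ^ n⌋₊ := by
      rw [(floor_mul_two_pow_eq_iff (h0.trans ht.1)).2 ht, div_mul_cancel₀ _ (by positivity),
        Nat.floor_natCast]
    have hS : ∀ f, S2 n f t = S2 n f ((j : ℝ) / 2 ^ n) := fun f =>
      Finset.sum_congr rfl fun k hk => by rw [walsh_congr (Finset.mem_range.1 hk) hfl]
    have hy : ybar t = ybar ((j : ℝ) / 2 ^ n) := by
      rw [hc, hc]
      exact Finset.sum_congr rfl fun k _ => by rw [walsh_congr k.2 hfl]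
    simp only [hg, hS, hy]
  rw [hcast] at hξ1 ⊢
  rw [hcast]
  push_cast at hξ2 ⊢
  have hpos : (0 : ℝ) < 2 ^ n := by positivity
  have hl : (l : ℝ) + 1 ≤ 2 ^ n := by exact_mod_cast hi
  have hle : (l : ℝ) / 2 ^ n ≤ ((l : ℝ) + 1) / 2 ^ n := by gcongr; linarith
  have hprim : ∀ s ∈ Set.uIcc ((l : ℝ) / 2 ^ n) (((l : ℝ) + 1) / 2 ^ n),
      ∫ t in ξ..s, g t =
        (∫ t in ξ..((l : ℝ) / 2 ^ n), g t) + g ((l : ℝ) / 2 ^ n) * (s - (l : ℝ) / 2 ^ n) := by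
    intro s hs
    rw [Set.uIcc_of_le hle] at hs
    rw [← intervalIntegral.integral_add_adjacent_intervals (hgint ξ ((l : ℝ) / 2 ^ n)) (hgint _ s),
      integral_of_const_on_Ico (hgc l) le_rfl hs.1 hs.2]
  have hmain := heq ((l : ℝ) / 2 ^ n) ⟨by positivity, by rw [div_lt_one hpos]; linarith⟩
  have hF : IntervalIntegrable (fun s => ∫ t in ξ..s, g t) volume 0 1 :=
    (intervalIntegral.continuous_primitive hgint ξ).intervalIntegrable 0 1
  rw [S2_eq_integral (by omega) hF,
    intervalIntegral.integral_congr hprim, integral_affine,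
    integral_dyadic_step hgint hgc hξ1 hξ2 (by omega)] at hmain
  have hsum : ∑ j ∈ Finset.Ioo (k + 1) (l + 1),
      (S2 n q (((j : ℝ) - 1) / 2 ^ n) -
        S2 n p (((j : ℝ) - 1) / 2 ^ n) * ybar (((j : ℝ) - 1) / 2 ^ n)) / 2 ^ n =
      ∑ j ∈ Finset.Ico (k + 1) l, g ((j : ℝ) / 2 ^ n) / 2 ^ n := by
    have hIoo : Finset.Ioo (k + 1) (l + 1) = Finset.Ico (k + 1 + 1) (l + 1) := by
      ext; simp
    rw [hIoo, ← Finset.sum_Ico_add' _ (k + 1) l 1]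
    exact Finset.sum_congr rfl fun j _ => by rw [hcast]
  rw [hsum]
  generalize ∑ j ∈ Finset.Ico (k + 1) l, g ((j : ℝ) / 2 ^ n) / 2 ^ n = T at hmain ⊢
  simp only [hg] at hmain
  rw [pow_succ]
  generalize S2 n q ((l : ℝ) / 2 ^ n) = Q at *
  generalize S2 n p ((l : ℝ) / 2 ^ n) = P at *
  generalize ybar ((l : ℝ) / 2 ^ n) = Y at *
  generalize (S2 n q ((k : ℝ) / 2 ^ n) - S2 n p ((k : ℝ) / 2 ^ n) * ybar ((k : ℝ) / 2 ^ n)) *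
    (((k : ℝ) + 1) / 2 ^ n - ξ) = K at *
  generalize (2 : ℝ) ^ n = N at *
  have hN : N ≠ 0 := hpos.ne'
  have hred : Y = η + (K + T + (Q - P * Y) / (2 * N)) := by
    refine hmain.trans ?_
    field_simp
    ring
  field_simp at hred ⊢
  linarith
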